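/- (Local SafeToOpen Lemma, parts 1–2) In a regular run, let x be a track with significant moments 0 = t_0 < t_1 < t_2 < …, and let s(x,t) denote the condition: TrackStatus(x,t) = empty or t + d_open < Deadline(x,t). If WaitTime > d_open, then s(x,·) holds on each interval [t_{3i}, t_{3i+1} + WaitTime − d_open) (the maximal positive intervals of s(x)) and fails on each interval [t_{3i+1} + WaitTime − d_open, t_{3i+3}). If WaitTime ≤ d_open, then s(x,·) holds on each interval [t_{3i}, t_{3i+1}] (the maximal positive intervals of s(x)) and fails on each interval (t_{3i+1}, t_{3i+3}). -/

import Mathlib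

namespace RailCross

inductive TStat : Type
  | emp | coming | incrossing
deriving DecidableEq

inductive DirV : Type
  | opn | cls
deriving DecidableEq

inductive GateV : Type
  | opened | closed
deriving DecidableEq

/-- `f` is piecewise constant on `[0, ∞)`: for every `τ > 0` there is a finite
partition `0 = s 0 < s 1 < … < s n = τ` such that `f` is constant on each open
subinterval `(s i, s (i+1))`. -/
def PWC {Y : Type*} (f : ℝ → Y) : Prop :=
  ∀ τ : ℝ, 0 < τ → ∃ n : ℕ, ∃ s : ℕ → ℝ,
    s 0 = 0 ∧ s n = τ ∧ (∀ i < n, s i < s (i + 1)) ∧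
    (∀ i < n, ∀ a b : ℝ, s i < a → a < b → b < s (i + 1) → f a = f b)

/-- `v` is the right-hand value `f(t+)`: `f` is constantly `v` on some `(t, t+ε)`. -/
def RightVal {Y : Type*} (f : ℝ → Y) (t : ℝ) (v : Y) : Prop :=
  ∃ ε : ℝ, 0 < ε ∧ ∀ u : ℝ, t < u → u < t + ε → f u = v

/-- `v` is the left-hand value `f(t−)` (for `t > 0`): `f` is constantly `v` on some `(t-ε, t)`. -/
def LeftVal {Y : Type*} (f : ℝ → Y) (t : ℝ) (v : Y) : Prop :=
  ∃ ε : ℝ, 0 < ε ∧ ε ≤ t ∧ ∀ u : ℝ, t - ε < u → u < t → f u = v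

/-- `tm` is the (finite or infinite) increasing sequence of significant moments of a
track with status function `f`; a finite sequence is encoded by letting `tm` take the
value `⊤ = ∞` from some point on. -/
structure TrainMotion (dmin dmax : ℝ) (f : ℝ → TStat) (tm : ℕ → EReal) : Prop where
  zero : tm 0 = 0
  mono : Monotone tm
  strict : ∀ i, tm i ≠ ⊤ → tm i < tm (i + 1)
  last_div : ∀ k, tm k ≠ ⊤ → tm (k + 1) = ⊤ → 3 ∣ k
  status_empty : ∀ i : ℕ, ∀ u : ℝ, tm (3 * i) ≤ (u : EReal) → (u : EReal) < tm (3 * i + 1) →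
    f u = TStat.emp
  status_coming : ∀ i : ℕ, ∀ u : ℝ, tm (3 * i + 1) ≤ (u : EReal) → (u : EReal) < tm (3 * i + 2) →
    f u = TStat.coming
  status_cross : ∀ i : ℕ, ∀ u : ℝ, tm (3 * i + 2) ≤ (u : EReal) → (u : EReal) < tm (3 * i + 3) →
    f u = TStat.incrossing
  gap : ∀ i : ℕ, ∀ a b : ℝ, tm (3 * i + 1) = (a : EReal) → tm (3 * i + 2) = (b : EReal) →
    dmin ≤ b - a ∧ b - a ≤ dmax

/-- `SafeToOpen(t)`: every track is empty or its deadline is more than `dopen` away. -/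
def SafeToOpen {Tracks : Type*} (dopen : ℝ) (trackStatus : Tracks → ℝ → TStat)
    (deadline : Tracks → ℝ → EReal) (t : ℝ) : Prop :=
  ∀ x : Tracks, trackStatus x t = TStat.emp ∨ ((t + dopen : ℝ) : EReal) < deadline x t

/-- A regular run of the railroad-crossing evolving algebra.  `WaitTime = dmin - dclose`. -/
structure RegularRun (Tracks : Type*) (dmin dmax dopen dclose : ℝ) where
  trackStatus : Tracks → ℝ → TStat
  deadline : Tracks → ℝ → EReal
  dir : ℝ → DirV
  gate : ℝ → GateV
  /-- the right-hand value `Deadline(x, t+)` -/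
  deadlinePlus : Tracks → ℝ → EReal
  /-- the right-hand value `Dir(t+)` -/
  dirPlus : ℝ → DirV
  /-- the right-hand value `GateStatus(t+)` -/
  gatePlus : ℝ → GateV
  pwc_ts : ∀ x, PWC (trackStatus x)
  pwc_dl : ∀ x, PWC (deadline x)
  pwc_dir : PWC dir
  pwc_gate : PWC gate
  dlPlus_spec : ∀ x, ∀ t : ℝ, 0 ≤ t → RightVal (deadline x) t (deadlinePlus x t)
  dirPlus_spec : ∀ t : ℝ, 0 ≤ t → RightVal dir t (dirPlus t)
  gatePlus_spec : ∀ t : ℝ, 0 ≤ t → RightVal gate t (gatePlus t)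
  dl_left : ∀ x, ∀ t : ℝ, 0 < t → LeftVal (deadline x) t (deadline x t)
  dir_left : ∀ t : ℝ, 0 < t → LeftVal dir t (dir t)
  gate_left : ∀ t : ℝ, 0 < t → LeftVal gate t (gate t)
  trainMotion : ∀ x, ∃ tm : ℕ → EReal, TrainMotion dmin dmax (trackStatus x) tm
  dl_init : ∀ x, deadline x 0 = ⊤
  dir_init : dir 0 = DirV.opn
  gate_init : gate 0 = GateV.opened
  dl_step_coming : ∀ x, ∀ t : ℝ, 0 ≤ t → trackStatus x t = TStat.coming → deadline x t = ⊤ →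
    deadlinePlus x t = ((t + (dmin - dclose) : ℝ) : EReal)
  dl_step_empty : ∀ x, ∀ t : ℝ, 0 ≤ t → trackStatus x t = TStat.emp → deadline x t ≠ ⊤ →
    deadlinePlus x t = ⊤
  dl_step_other : ∀ x, ∀ t : ℝ, 0 ≤ t →
    ¬(trackStatus x t = TStat.coming ∧ deadline x t = ⊤) →
    ¬(trackStatus x t = TStat.emp ∧ deadline x t ≠ ⊤) →
    deadlinePlus x t = deadline x t
  dir_step_close : ∀ t : ℝ, 0 ≤ t → (∃ x, deadline x t = (t : EReal)) → dirPlus t = DirV.cls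
  dir_step_open : ∀ t : ℝ, 0 ≤ t → (∀ x, deadline x t ≠ (t : EReal)) → dir t = DirV.cls →
    SafeToOpen dopen trackStatus deadline t → dirPlus t = DirV.opn
  dir_step_other : ∀ t : ℝ, 0 ≤ t → (∀ x, deadline x t ≠ (t : EReal)) →
    ¬(dir t = DirV.cls ∧ SafeToOpen dopen trackStatus deadline t) → dirPlus t = dir t
  gate_step : ∀ t : ℝ, 0 ≤ t →
    gatePlus t = gate t ∨ (dir t = DirV.opn ∧ gatePlus t = GateV.opened) ∨
      (dir t = DirV.cls ∧ gatePlus t = GateV.closed)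
  gate_close_bound : ∀ t : ℝ, 0 ≤ t →
    ¬(∀ u ∈ Set.Ioo t (t + dclose), dir u = DirV.cls ∧ gate u = GateV.opened)
  gate_open_bound : ∀ t : ℝ, 0 ≤ t →
    ¬(∀ u ∈ Set.Ioo t (t + dopen), dir u = DirV.opn ∧ gate u = GateV.closed)

/-- A left-continuous function that takes the value `v` just after `a`, and keeps it just after
every point of `(a, b)` where it has it, is equal to `v` on `(a, b]`. -/
theorem eq_of_rightVal_of_leftVal {Y : Type*} {f : ℝ → Y} {v : Y} {a b : ℝ}
    (ha : RightVal f a v) (hl : ∀ t, a < t → LeftVal f t (f t))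
    (hr : ∀ t, a < t → t < b → f t = v → RightVal f t v) :
    ∀ u, a < u → u ≤ b → f u = v := by
  by_contra! hne
  obtain ⟨w, haw, hwb, hw⟩ := hne
  set B : Set ℝ := {u | a < u ∧ f u ≠ v}
  have hwB : w ∈ B := ⟨haw, hw⟩
  have hbdd : BddBelow B := ⟨a, fun u hu => hu.1.le⟩
  have hac : a ≤ sInf B := le_csInf ⟨w, hwB⟩ fun u hu => hu.1.le
  have hcw : sInf B ≤ w := csInf_le hbdd hwB
  have hbelow : ∀ u, a < u → u < sInf B → f u = v := fun u hau huc => by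
    by_contra h
    exact absurd (csInf_le hbdd (show u ∈ B from ⟨hau, h⟩)) (not_le.mpr huc)
  have hnot : f (sInf B) = v ∨ sInf B = a → ¬ RightVal f (sInf B) v := by
    rintro hc ⟨ε, hε, h⟩
    obtain ⟨u, huB, hu⟩ := exists_lt_of_csInf_lt ⟨w, hwB⟩ (lt_add_of_pos_right (sInf B) hε)
    rcases (csInf_le hbdd huB).eq_or_lt with heq | hlt
    · rcases hc with hc | hc
      · exact huB.2 (heq ▸ hc)
      · exact absurd huB.1 (by rw [← heq, hc]; exact lt_irrefl a)
    · exact huB.2 (h u hlt hu)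
  rcases hac.eq_or_lt with heq | hlt
  · exact hnot (Or.inr heq.symm) (heq ▸ ha)
  · have hfc : f (sInf B) = v := by
      obtain ⟨ε, hε, -, h⟩ := hl _ hlt
      obtain ⟨u, hu, huc⟩ := exists_between (max_lt hlt (sub_lt_self (sInf B) hε))
      rw [← h u ((le_max_right _ _).trans_lt hu) huc]
      exact hbelow u ((le_max_left _ _).trans_lt hu) huc
    rcases hcw.eq_or_lt with heq | hcw
    · exact hw (heq ▸ hfc)
    · exact hnot (Or.inl hfc) (hr _ hlt (hcw.trans_le hwb) hfc)

namespace TrainMotion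

variable {dmin dmax : ℝ} {f : ℝ → TStat} {tm : ℕ → EReal}

theorem nonneg (h : TrainMotion dmin dmax f tm) (k : ℕ) : 0 ≤ tm k :=
  h.zero ▸ h.mono (Nat.zero_le k)

theorem exists_coe (h : TrainMotion dmin dmax f tm) {k : ℕ} (hk : tm k ≠ ⊤) :
    ∃ a : ℝ, 0 ≤ a ∧ tm k = a := by
  have hbot : tm k ≠ ⊥ := fun hb => by simpa [hb] using h.nonneg k
  have ha := EReal.coe_toReal hk hbot
  exact ⟨(tm k).toReal, EReal.toReal_nonneg (h.nonneg k), ha.symm⟩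

/-- A train that has arrived reaches the crossing after at least `dmin`. -/
theorem add_le_crossing (h : TrainMotion dmin dmax f tm) {i : ℕ} {a : ℝ}
    (ha : tm (3 * i + 1) = a) : ((a + dmin : ℝ) : EReal) ≤ tm (3 * i + 2) := by
  have htop : tm (3 * i + 2) ≠ ⊤ := fun hb => by
    have := h.last_div (3 * i + 1) (by simp [ha]) hb
    omega
  obtain ⟨b, -, hb⟩ := h.exists_coe htop
  rw [hb, EReal.coe_le_coe_iff]
  linarith [(h.gap i a b ha hb).1]

theorem status_ne_emp (h : TrainMotion dmin dmax f tm) {i : ℕ} {u : ℝ}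
    (h1 : tm (3 * i + 1) ≤ u) (h2 : (u : EReal) < tm (3 * i + 3)) : f u ≠ TStat.emp := by
  rcases lt_or_ge (u : EReal) (tm (3 * i + 2)) with hu | hu
  · simp [h.status_coming i u h1 hu]
  · simp [h.status_cross i u hu h2]

end TrainMotion

namespace RegularRun

variable {Tracks : Type*} {dmin dmax dopen dclose : ℝ}

/-- The deadline is infinite at the arrival of a train. -/
theorem deadline_arrival (R : RegularRun Tracks dmin dmax dopen dclose) {x : Tracks}
    {tm : ℕ → EReal} (htm : TrainMotion dmin dmax (R.trackStatus x) tm) {i : ℕ} {a : ℝ}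
    (ha : tm (3 * i + 1) = a) : R.deadline x a = ⊤ := by
  have hne : tm (3 * i) ≠ ⊤ := fun hb => by
    have := htm.mono (Nat.le_succ (3 * i))
    simp [hb, ha] at this
  obtain ⟨c, hc0, hc⟩ := htm.exists_coe hne
  have hca : c < a := by
    have := htm.strict _ hne
    rwa [hc, ha, EReal.coe_lt_coe_iff] at this
  have hemp : ∀ t, c ≤ t → t < a → R.trackStatus x t = TStat.emp := fun t h1 h2 =>
    htm.status_empty i t (by rw [hc]; exact_mod_cast h1) (by rw [ha]; exact_mod_cast h2)
  have hright : ∀ t, c ≤ t → t < a → RightVal (R.deadline x) t ⊤ := fun t h1 h2 => by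
    have hs := hemp t h1 h2
    have ht : 0 ≤ t := hc0.trans h1
    have hplus : R.deadlinePlus x t = ⊤ := by
      by_cases hd : R.deadline x t = ⊤
      · rw [R.dl_step_other x t ht (by simp [hs]) (by simp [hd]), hd]
      · exact R.dl_step_empty x t ht hs hd
    exact hplus ▸ R.dlPlus_spec x t ht
  exact eq_of_rightVal_of_leftVal (hright c le_rfl hca)
    (fun t ht => R.dl_left x t (hc0.trans_lt ht)) (fun t h1 h2 _ => hright t h1.le h2) a hca le_rfl

/-- From the arrival of a train at time `a` until it leaves the crossing, the deadline is
`a + WaitTime`. -/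
theorem deadline_after_arrival (R : RegularRun Tracks dmin dmax dopen dclose) {x : Tracks}
    {tm : ℕ → EReal} (htm : TrainMotion dmin dmax (R.trackStatus x) tm) (hdmin : 0 < dmin)
    {i : ℕ} {a u : ℝ} (ha : tm (3 * i + 1) = a) (hau : a < u)
    (hu : (u : EReal) ≤ tm (3 * i + 3)) :
    R.deadline x u = ((a + (dmin - dclose) : ℝ) : EReal) := by
  have ha0 : 0 ≤ a := by
    have := htm.nonneg (3 * i + 1)
    rw [ha] at this
    exact_mod_cast this
  have hcoming : R.trackStatus x a = TStat.coming :=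
    htm.status_coming i a ha.le
      (lt_of_lt_of_le (by exact_mod_cast lt_add_of_pos_right a hdmin) (htm.add_le_crossing ha))
  refine eq_of_rightVal_of_leftVal (b := u) ?_
    (fun t ht => R.dl_left x t (ha0.trans_lt ht)) (fun t h1 h2 hd => ?_) u hau le_rfl
  · rw [← R.dl_step_coming x a ha0 hcoming (R.deadline_arrival htm ha)]
    exact R.dlPlus_spec x a ha0
  · have ht : 0 ≤ t := ha0.trans h1.le
    have hs : R.trackStatus x t ≠ TStat.emp :=
      htm.status_ne_emp (i := i) (by rw [ha]; exact_mod_cast h1.le)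
        (lt_of_lt_of_le (by exact_mod_cast h2) hu)
    have hfin : R.deadline x t ≠ ⊤ := by rw [hd]; exact EReal.coe_ne_top _
    rw [← hd, ← R.dl_step_other x t ht (by simp [hfin]) (by simp [hs])]
    exact R.dlPlus_spec x t ht

end RegularRun

theorem local_safe_to_open_1_2 {Tracks : Type*} [Fintype Tracks] [Nonempty Tracks]
    {dmin dmax dopen dclose : ℝ}
    (hdmin : 0 < dmin) (hdmax : 0 < dmax) (hdopen : 0 < dopen) (hdclose : 0 < dclose)
    (hcm : dclose < dmin) (hmm : dmin ≤ dmax)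
    (R : RegularRun Tracks dmin dmax dopen dclose)
    (x : Tracks) (tm : ℕ → EReal) (htm : TrainMotion dmin dmax (R.trackStatus x) tm) :
    (dopen < dmin - dclose →
      (∀ i : ℕ, ∀ u : ℝ, tm (3 * i) ≤ (u : EReal) →
          (u : EReal) < tm (3 * i + 1) + ((dmin - dclose - dopen : ℝ) : EReal) →
          (R.trackStatus x u = TStat.emp ∨ ((u + dopen : ℝ) : EReal) < R.deadline x u)) ∧
      (∀ i : ℕ, ∀ u : ℝ, tm (3 * i + 1) + ((dmin - dclose - dopen : ℝ) : EReal) ≤ (u : EReal) →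
          (u : EReal) < tm (3 * i + 3) →
          ¬(R.trackStatus x u = TStat.emp ∨ ((u + dopen : ℝ) : EReal) < R.deadline x u))) ∧
    (dmin - dclose ≤ dopen →
      (∀ i : ℕ, ∀ u : ℝ, tm (3 * i) ≤ (u : EReal) → (u : EReal) ≤ tm (3 * i + 1) →
          (R.trackStatus x u = TStat.emp ∨ ((u + dopen : ℝ) : EReal) < R.deadline x u)) ∧
      (∀ i : ℕ, ∀ u : ℝ, tm (3 * i + 1) < (u : EReal) → (u : EReal) < tm (3 * i + 3) →
          ¬(R.trackStatus x u = TStat.emp ∨ ((u + dopen : ℝ) : EReal) < R.deadline x u))) := by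
  have not_safe : ∀ i : ℕ, ∀ a u : ℝ, tm (3 * i + 1) = a → a < u → (u : EReal) < tm (3 * i + 3) →
      a + (dmin - dclose) ≤ u + dopen →
      ¬(R.trackStatus x u = TStat.emp ∨ ((u + dopen : ℝ) : EReal) < R.deadline x u) := by
    intro i a u ha hau hu hle
    rw [R.deadline_after_arrival htm hdmin ha hau hu.le, EReal.coe_lt_coe_iff]
    rintro (h | h)
    · exact htm.status_ne_emp (i := i) (by rw [ha]; exact_mod_cast hau.le) hu h
    · exact absurd h (not_lt.mpr hle)
  have safe_of_le : ∀ i : ℕ, ∀ u : ℝ, tm (3 * i) ≤ (u : EReal) → (u : EReal) ≤ tm (3 * i + 1) →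
      (R.trackStatus x u = TStat.emp ∨ ((u + dopen : ℝ) : EReal) < R.deadline x u) := by
    intro i u h1 h2
    rcases h2.eq_or_lt with h | h
    · right
      rw [R.deadline_arrival htm h.symm]
      exact EReal.coe_lt_top _
    · exact Or.inl (htm.status_empty i u h1 h)
  have arrival_coe : ∀ i : ℕ, ∀ u : ℝ, tm (3 * i + 1) < (u : EReal) →
      ∃ a : ℝ, tm (3 * i + 1) = a ∧ a < u := by
    intro i u hu
    obtain ⟨a, -, ha⟩ := htm.exists_coe (hu.trans (EReal.coe_lt_top u)).ne
    exact ⟨a, ha, by rwa [ha, EReal.coe_lt_coe_iff] at hu⟩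
  refine ⟨fun hlt => ⟨fun i u h1 h2 => ?_, fun i u h1 h2 => ?_⟩,
    fun hle => ⟨safe_of_le, fun i u h1 h2 => ?_⟩⟩
  · rcases le_or_gt (u : EReal) (tm (3 * i + 1)) with h | h
    · exact safe_of_le i u h1 h
    · right
      obtain ⟨a, ha, hau⟩ := arrival_coe i u h
      rw [ha, ← EReal.coe_add, EReal.coe_lt_coe_iff] at h2
      have hu : (u : EReal) ≤ tm (3 * i + 3) :=
        le_trans (by exact_mod_cast (by linarith : u ≤ a + dmin))
          ((htm.add_le_crossing ha).trans (htm.mono (Nat.le_succ _)))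
      rw [R.deadline_after_arrival htm hdmin ha hau hu, EReal.coe_lt_coe_iff]
      linarith
  · have htop : tm (3 * i + 1) ≠ ⊤ := fun h => by
      rw [h, EReal.top_add_coe] at h1
      exact EReal.coe_ne_top u (top_le_iff.mp h1)
    obtain ⟨a, -, ha⟩ := htm.exists_coe htop
    rw [ha, ← EReal.coe_add, EReal.coe_le_coe_iff] at h1
    exact not_safe i a u ha (by linarith) h2 (by linarith)
  · obtain ⟨a, ha, hau⟩ := arrival_coe i u h1
    exact not_safe i a u ha hau h2 (by linarith)

end RailCross
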